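/- arXiv:1702.06997 — 10 statements merged into one kernel-verified Lean document; each statement's English description precedes it below -/
import Mathlib

section
/- For all naturals n, s, N, every choice of terms T : Fin N → (Fin s → Fin n), clauses C : Fin N → Fin N → (Fin s → Fin n), and dictator indices κ : Fin N → Fin N → Fin n, the function f_{T,C,h} obtained by taking h i j x = x (κ i j) (each h i j a dictatorship function) is monotone: for all strings x, y, if x k = true implies y k = true for every coordinate k, then f x = true implies f y = true. -/
open scoped Classical

/-- `x` satisfies the term `T` if all variables of `T` are true in `x`. -/
def Satisfies {n s : ℕ} (x : Fin n → Bool) (T : Fin s → Fin n) : Prop :=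
  ∀ m, x (T m) = true

/-- `x` falsifies the clause `Cl` if all variables of `Cl` are false in `x`. -/
def Falsifies {n s : ℕ} (x : Fin n → Bool) (Cl : Fin s → Fin n) : Prop :=
  ∀ m, x (Cl m) = false

/-- `x` with coordinate `k` flipped. -/
def flipCoord {n : ℕ} (x : Fin n → Bool) (k : Fin n) : Fin n → Bool :=
  Function.update x k (!x k)

/-- The number of true coordinates of `x`. -/
def weight {n : ℕ} (x : Fin n → Bool) : ℕ :=
  (Finset.univ.filter fun k => x k = true).card

/-- The multiplexer map `Γ_{T,C}`; `Sum.inr false` is `0*`, `Sum.inr true` is `1*`. -/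
noncomputable def Gamma {n s N : ℕ} (T : Fin N → Fin s → Fin n)
    (C : Fin N → Fin N → Fin s → Fin n) (x : Fin n → Bool) :
    (Fin N × Fin N) ⊕ Bool :=
  if h1 : ∃! i, Satisfies x (T i) then
    if h2 : ∃! j, Falsifies x (C (Classical.choose h1) j) then
      Sum.inl (Classical.choose h1, Classical.choose h2)
    else if ∃ j, Falsifies x (C (Classical.choose h1) j) then Sum.inr false
    else Sum.inr true
  else if ∃ i, Satisfies x (T i) then Sum.inr true
  else Sum.inr false

/-- The function `f_{T,C,h}`. -/
noncomputable def fTCH {n s N : ℕ} (T : Fin N → Fin s → Fin n)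
    (C : Fin N → Fin N → Fin s → Fin n)
    (h : Fin N → Fin N → (Fin n → Bool) → Bool) (x : Fin n → Bool) : Bool :=
  if ((n : ℝ) / 2 + s) < (weight x : ℝ) then true
  else if ((weight x : ℝ)) < ((n : ℝ) / 2 - s) then false
  else
    match Gamma T C x with
    | Sum.inl (i, j) => h i j x
    | Sum.inr b => b

theorem Satisfies.mono {n s : ℕ} {x y : Fin n → Bool} {t : Fin s → Fin n}
    (hxy : ∀ k, x k = true → y k = true) (h : Satisfies x t) : Satisfies y t :=
  fun m => hxy _ (h m)

theorem Falsifies.anti {n s : ℕ} {x y : Fin n → Bool} {c : Fin s → Fin n}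
    (hxy : ∀ k, x k = true → y k = true) (h : Falsifies y c) : Falsifies x c := by
  intro m
  by_contra hm
  have h₁ := hxy _ (by simpa using hm)
  have h₂ := h m
  simp_all

theorem weight_mono {n : ℕ} {x y : Fin n → Bool}
    (hxy : ∀ k, x k = true → y k = true) : weight x ≤ weight y :=
  Finset.card_le_card (Finset.monotone_filter_right _ fun k _ => hxy k)

/-- The multiplexed value is true iff two terms are satisfied, or a satisfied term has at most one
falsified clause, whose bottom function (if there is such a clause) is true. -/
theorem match_Gamma_eq_true_iff {n s N : ℕ} (T : Fin N → Fin s → Fin n)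
    (C : Fin N → Fin N → Fin s → Fin n) (h : Fin N → Fin N → (Fin n → Bool) → Bool)
    (x : Fin n → Bool) :
    (match Gamma T C x with
      | Sum.inl (i, j) => h i j x
      | Sum.inr b => b) = true ↔
    ∃ i, Satisfies x (T i) ∧ ((∃ i', i' ≠ i ∧ Satisfies x (T i')) ∨
      ∀ j, Falsifies x (C i j) →
        h i j x = true ∧ ∀ j', Falsifies x (C i j') → j' = j) := by
  unfold Gamma
  by_cases h1 : ∃! i, Satisfies x (T i)
  · rw [dif_pos h1]
    obtain ⟨hi, hu⟩ := Classical.choose_spec h1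
    generalize Classical.choose h1 = i at hi hu ⊢
    by_cases h2 : ∃! j, Falsifies x (C i j)
    · rw [dif_pos h2]
      obtain ⟨hj, hv⟩ := Classical.choose_spec h2
      generalize Classical.choose h2 = j at hj hv ⊢
      grind
    · rw [dif_neg h2]
      unfold ExistsUnique at h2
      split_ifs <;> grind
  · rw [dif_neg h1]
    unfold ExistsUnique at h1
    split_ifs <;> grind

/-- with dictator bottom functions, `f_{T,C,h}` is monotone. -/
theorem statement0 (n s N : ℕ) (T : Fin N → Fin s → Fin n)
    (C : Fin N → Fin N → Fin s → Fin n) (κ : Fin N → Fin N → Fin n)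
    (x y : Fin n → Bool) (hxy : ∀ k, x k = true → y k = true)
    (hx : fTCH T C (fun i j z => z (κ i j)) x = true) :
    fTCH T C (fun i j z => z (κ i j)) y = true := by
  have hw : (weight x : ℝ) ≤ weight y := by exact_mod_cast weight_mono hxy
  unfold fTCH at hx ⊢
  split_ifs with hy₁ hy₂
  · rfl
  · rw [if_neg (by linarith), if_pos (by linarith)] at hx
    exact Bool.false_ne_true hx
  · rw [if_neg (by linarith)] at hx
    split_ifs at hx
    rw [match_Gamma_eq_true_iff T C fun i j z => z (κ i j)] at hx ⊢
    obtain ⟨i, hi, ⟨i', hne, hi'⟩ | hC⟩ := hx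
    · exact ⟨i, hi.mono hxy, Or.inl ⟨i', hne, hi'.mono hxy⟩⟩
    · refine ⟨i, hi.mono hxy, Or.inr fun j hj => ?_⟩
      obtain ⟨hκ, hu⟩ := hC j (hj.anti hxy)
      exact ⟨hxy _ hκ, fun j' hj' => hu j' (hj'.anti hxy)⟩
end

section
/- For all naturals n, s, N, terms T : Fin N → (Fin s → Fin n), clauses C : Fin N → Fin N → (Fin s → Fin n), anti-dictator indices κ : Fin N → Fin N → Fin n, and a string x, let f = f_{T,C,h} with h i j x = ¬ x (κ i j) (each h i j an anti-dictatorship function). Suppose Γ_{T,C}(x) = (i, j), x (κ i j) = false, κ i j is not in the range of the clause C i j, for every i' ≠ i the flipped string x^(κ i j) does not satisfy T i', and (over ℝ) n/2 − s ≤ |x| and |x| + 1 ≤ n/2 + s. Then f x = true and f (x^(κ i j)) = false; that is, the edge (x, x^(κ i j)) violates monotonicity of f. -/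
open scoped Classical

theorem Gamma_eq_inl_iff {n s N : ℕ} {T : Fin N → Fin s → Fin n}
    {C : Fin N → Fin N → Fin s → Fin n} {x : Fin n → Bool} {i j : Fin N} :
    Gamma T C x = Sum.inl (i, j) ↔
      (Satisfies x (T i) ∧ ∀ i', Satisfies x (T i') → i' = i) ∧
        Falsifies x (C i j) ∧ ∀ j', Falsifies x (C i j') → j' = j := by
  constructor
  · intro h
    unfold Gamma at h
    split_ifs at h with h1 h2
    obtain ⟨rfl, rfl⟩ := Prod.mk.inj (Sum.inl.inj h)
    exact ⟨Classical.choose_spec h1, Classical.choose_spec h2⟩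
  · rintro ⟨hi, hj⟩
    have h1 : ∃! i, Satisfies x (T i) := ⟨i, hi⟩
    have hi' : Classical.choose h1 = i := hi.2 _ (Classical.choose_spec h1).1
    have h2 : ∃! j, Falsifies x (C (Classical.choose h1) j) := by
      rw [hi']
      exact ⟨j, hj⟩
    have hj' : Classical.choose h2 = j := by
      apply hj.2
      have h : Falsifies x (C (Classical.choose h1) (Classical.choose h2)) :=
        (Classical.choose_spec h2).1
      exact hi' ▸ h
    unfold Gamma
    rw [dif_pos h1, dif_pos h2]
    exact congrArg Sum.inl (Prod.ext hi' hj')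

theorem flipCoord_self {n : ℕ} (x : Fin n → Bool) (k : Fin n) :
    flipCoord x k k = !x k := by
  simp [flipCoord]

theorem flipCoord_of_ne {n : ℕ} (x : Fin n → Bool) {k l : Fin n} (h : l ≠ k) :
    flipCoord x k l = x l := by
  simp [flipCoord, h]

theorem weight_flipCoord_of_false {n : ℕ} {x : Fin n → Bool} {k : Fin n}
    (hk : x k = false) : weight (flipCoord x k) = weight x + 1 := by
  have h : (Finset.univ.filter fun l => flipCoord x k l = true) =
      insert k (Finset.univ.filter fun l => x l = true) := by
    ext l
    by_cases hl : l = k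
    · subst hl
      simp [flipCoord_self, hk]
    · simp [flipCoord_of_ne x hl, hl]
  unfold weight
  rw [h, Finset.card_insert_of_notMem (by simp [hk])]

theorem Satisfies.flip {n s : ℕ} {x : Fin n → Bool} {t : Fin s → Fin n} {k : Fin n}
    (h : Satisfies x t) (hk : x k = false) : Satisfies (flipCoord x k) t := by
  intro m
  have hm : t m ≠ k := by
    rintro rfl
    simp [h m] at hk
  rw [flipCoord_of_ne x hm, h m]

theorem Falsifies.flip {n s : ℕ} {x : Fin n → Bool} {c : Fin s → Fin n} {k : Fin n}
    (h : Falsifies x c) (hc : ∀ m, c m ≠ k) : Falsifies (flipCoord x k) c := by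
  intro m
  rw [flipCoord_of_ne x (hc m), h m]

theorem Falsifies.of_flip {n s : ℕ} {x : Fin n → Bool} {c : Fin s → Fin n} {k : Fin n}
    (h : Falsifies (flipCoord x k) c) (hk : x k = false) : Falsifies x c := by
  intro m
  by_cases hm : c m = k
  · rw [hm, hk]
  · rw [← flipCoord_of_ne x hm, h m]

theorem fTCH_of_Gamma_eq_inl {n s N : ℕ} {T : Fin N → Fin s → Fin n}
    {C : Fin N → Fin N → Fin s → Fin n} (h : Fin N → Fin N → (Fin n → Bool) → Bool)
    {x : Fin n → Bool} {i j : Fin N} (hΓ : Gamma T C x = Sum.inl (i, j))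
    (hlow : (n : ℝ) / 2 - s ≤ (weight x : ℝ))
    (hhigh : (weight x : ℝ) ≤ (n : ℝ) / 2 + s) :
    fTCH T C h x = h i j x := by
  unfold fTCH
  rw [if_neg hhigh.not_gt, if_neg hlow.not_gt, hΓ]

/-- with anti-dictator bottom functions, `(x, x^(κ i j))` is a
violating edge of `f_{T,C,h}`. -/
theorem statement3 (n s N : ℕ) (T : Fin N → Fin s → Fin n)
    (C : Fin N → Fin N → Fin s → Fin n) (κ : Fin N → Fin N → Fin n)
    (x : Fin n → Bool) (i j : Fin N)
    (hΓ : Gamma T C x = Sum.inl (i, j))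
    (hxk : x (κ i j) = false)
    (hE1 : ∀ m : Fin s, C i j m ≠ κ i j)
    (hE2 : ∀ i' : Fin N, i' ≠ i → ¬ Satisfies (flipCoord x (κ i j)) (T i'))
    (hlow : (n : ℝ) / 2 - s ≤ (weight x : ℝ))
    (hhigh : (weight x : ℝ) + 1 ≤ (n : ℝ) / 2 + s) :
    fTCH T C (fun i' j' z => !(z (κ i' j'))) x = true ∧
    fTCH T C (fun i' j' z => !(z (κ i' j'))) (flipCoord x (κ i j)) = false := by
  obtain ⟨⟨hi, -⟩, hj, hj'⟩ := Gamma_eq_inl_iff.mp hΓ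
  have hΓ' : Gamma T C (flipCoord x (κ i j)) = Sum.inl (i, j) :=
    Gamma_eq_inl_iff.mpr
      ⟨⟨hi.flip hxk, fun i' h => by_contra fun hne => hE2 i' hne h⟩,
        hj.flip hE1, fun j' h => hj' j' (h.of_flip hxk)⟩
  have hw : (weight (flipCoord x (κ i j)) : ℝ) = weight x + 1 := by
    rw [weight_flipCoord_of_false hxk]
    push_cast
    rfl
  constructor
  · rw [fTCH_of_Gamma_eq_inl _ hΓ hlow (by linarith), hxk]
    rfl
  · rw [fTCH_of_Gamma_eq_inl _ hΓ' (by linarith) (by linarith), flipCoord_self, hxk]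
    rfl
end

section
/- For all naturals n, s, N, terms T : Fin N → (Fin s → Fin n), clauses C : Fin N → Fin N → (Fin s → Fin n), indices κ : Fin N → Fin N → Fin n, and strings x, y, suppose Γ_{T,C}(x) = (i₁, j₁) with x (κ i₁ j₁) = false and Γ_{T,C}(x^(κ i₁ j₁)) = (i₁, j₁), and likewise Γ_{T,C}(y) = (i₂, j₂) with y (κ i₂ j₂) = false and Γ_{T,C}(y^(κ i₂ j₂)) = (i₂, j₂). If x^(κ i₁ j₁) = y^(κ i₂ j₂), then x = y. (Consequently the violating edges produced by the construction are pairwise disjoint.) -/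
open scoped Classical

/-- the violating edges produced by the construction are pairwise
disjoint: one can reconstruct `x` from the flipped string. -/
theorem statement4 (n s N : ℕ) (T : Fin N → Fin s → Fin n)
    (C : Fin N → Fin N → Fin s → Fin n) (κ : Fin N → Fin N → Fin n)
    (x y : Fin n → Bool) (i₁ j₁ i₂ j₂ : Fin N)
    (hx1 : Gamma T C x = Sum.inl (i₁, j₁)) (hx2 : x (κ i₁ j₁) = false)
    (hx3 : Gamma T C (flipCoord x (κ i₁ j₁)) = Sum.inl (i₁, j₁))
    (hy1 : Gamma T C y = Sum.inl (i₂, j₂)) (hy2 : y (κ i₂ j₂) = false)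
    (hy3 : Gamma T C (flipCoord y (κ i₂ j₂)) = Sum.inl (i₂, j₂))
    (heq : flipCoord x (κ i₁ j₁) = flipCoord y (κ i₂ j₂)) :
    x = y := by
  rw [heq, hy3, Sum.inl.injEq, Prod.mk.injEq] at hx3
  obtain ⟨rfl, rfl⟩ := hx3
  funext k
  by_cases hk : k = κ i₂ j₂
  · rw [hk, hx2, hy2]
  · simpa [flipCoord, Function.update_of_ne hk] using congrFun heq k
end

section
/- Let n be a natural number, f : (Fin n → Bool) → Bool, and let M be a finite set of pairs (x, k) with x : Fin n → Bool and k : Fin n such that for each (x, k) ∈ M: x k = false, f x = true, and f (x^(k)) = false; assume moreover that the 2·|M| strings {x, x^(k) : (x, k) ∈ M} are pairwise distinct. Then for every monotone g : (Fin n → Bool) → Bool, the number of strings z : Fin n → Bool with f z ≠ g z is at least |M|. -/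
open scoped Classical

/-- Flipping a false coordinate only enlarges a string. -/
theorem le_flipCoord {n : ℕ} {x : Fin n → Bool} {k : Fin n} (hk : x k = false) :
    ∀ i, x i = true → flipCoord x k i = true := by
  intro i hi
  have hik : i ≠ k := by
    rintro rfl
    simp [hk] at hi
  simpa [flipCoord, hik] using hi

/-- a collection of pairwise-disjoint violating edges gives a lower
bound on the distance to every monotone function. -/
theorem statement5 (n : ℕ) (f : (Fin n → Bool) → Bool)
    (M : Finset ((Fin n → Bool) × Fin n))
    (hM : ∀ p ∈ M, p.1 p.2 = false ∧ f p.1 = true ∧ f (flipCoord p.1 p.2) = false)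
    (hdist : ∀ p ∈ M, ∀ q ∈ M, ∀ b c : Bool,
      (cond b (flipCoord p.1 p.2) p.1) = (cond c (flipCoord q.1 q.2) q.1) →
      p = q ∧ b = c)
    (g : (Fin n → Bool) → Bool)
    (hg : ∀ x y : Fin n → Bool, (∀ k, x k = true → y k = true) →
      g x = true → g y = true) :
    M.card ≤ (Finset.univ.filter fun z : Fin n → Bool => f z ≠ g z).card := by
  refine Finset.card_le_card_of_injOn
    (fun p => cond (g p.1) (flipCoord p.1 p.2) p.1) ?_ ?_
  · intro p hp
    obtain ⟨hk, hx, hy⟩ := hM p hp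
    simp only [Finset.coe_filter, Finset.mem_univ, true_and, Set.mem_ofPred_eq]
    cases hgx : g p.1 with
    | false => simp [hx, hgx]
    | true =>
      have hgy := hg _ _ (le_flipCoord hk) hgx
      simp [hy, hgy]
  · intro p hp q hq h
    exact (hdist p hp q hq _ _ h).1
end

section
/- There exist a real constant c > 0 and a natural s₀ such that for all naturals s ≥ s₀, setting n = s² and N = 2^s, for every natural w with (over ℝ) n/2 − s ≤ w ≤ n/2 + s: (w/n)^s · (1 − ((w + 1)/n)^s)^(N − 1) ≥ c/N. -/
theorem Real.exp_neg_two_mul_le_one_sub {x : ℝ} (h0 : 0 ≤ x) (h1 : x ≤ 1 / 2) :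
    Real.exp (-(2 * x)) ≤ 1 - x := by
  have h := Real.add_one_le_exp (2 * x)
  rw [Real.exp_neg, inv_le_comm₀ (Real.exp_pos _) (by linarith), inv_eq_one_div,
    div_le_iff₀ (by linarith)]
  nlinarith

theorem Real.exp_neg_le_one_sub_pow {x b : ℝ} {m : ℕ} (h0 : 0 ≤ x) (h1 : x ≤ 1 / 2)
    (h : 2 * (m * x) ≤ b) : Real.exp (-b) ≤ (1 - x) ^ m := by
  calc Real.exp (-b) ≤ Real.exp (m * -(2 * x)) := Real.exp_le_exp.2 (by linarith)
    _ = Real.exp (-(2 * x)) ^ m := Real.exp_nat_mul _ _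
    _ ≤ _ := pow_le_pow_left₀ (Real.exp_pos _).le (Real.exp_neg_two_mul_le_one_sub h0 h1) m

/-- the probability that a fixed middle-layer string and its upward
neighbor uniquely satisfy a given one of N random width-s terms is Ω(1/N). -/
theorem statement8 : ∃ c : ℝ, 0 < c ∧ ∃ s₀ : ℕ, ∀ s : ℕ, s₀ ≤ s → ∀ w : ℕ,
    ((s : ℝ) ^ 2 / 2 - s ≤ (w : ℝ)) → ((w : ℝ) ≤ (s : ℝ) ^ 2 / 2 + s) →
    c / (2 ^ s : ℝ) ≤
      ((w : ℝ) / (s : ℝ) ^ 2) ^ s *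
        (1 - (((w : ℝ) + 1) / (s : ℝ) ^ 2) ^ s) ^ (2 ^ s - 1) := by
  refine ⟨Real.exp (-4) * Real.exp (-(2 * Real.exp 4)), by positivity, 8, ?_⟩
  intro s hs w hl hu
  have hs' : (8 : ℝ) ≤ s := by exact_mod_cast hs
  have hs0 : (0 : ℝ) < s := by linarith
  have hN : (256 : ℝ) ≤ 2 ^ s := by
    calc (256 : ℝ) = 2 ^ 8 := by norm_num
      _ ≤ 2 ^ s := pow_le_pow_right₀ (by norm_num) hs
  have hfirst : Real.exp (-4) / 2 ^ s ≤ ((w : ℝ) / (s : ℝ) ^ 2) ^ s := by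
    have h2 : (2 : ℝ) / s ≤ 1 / 2 := by rw [div_le_iff₀ hs0]; linarith
    calc Real.exp (-4) / 2 ^ s ≤ (1 - 2 / s) ^ s / 2 ^ s := by
          gcongr
          exact Real.exp_neg_le_one_sub_pow (by positivity) h2 (by field_simp; norm_num)
      _ = ((1 - 2 / s) / 2 : ℝ) ^ s := (div_pow _ _ _).symm
      _ ≤ _ := by
          refine pow_le_pow_left₀ (by linarith) ?_ s
          rw [le_div_iff₀ (by positivity)]
          calc (1 - 2 / s) / 2 * (s : ℝ) ^ 2 = (s : ℝ) ^ 2 / 2 - s := by field_simp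
            _ ≤ (w : ℝ) := hl
  have hq : (((w : ℝ) + 1) / (s : ℝ) ^ 2) ^ s ≤ Real.exp 4 / 2 ^ s := by
    calc (((w : ℝ) + 1) / (s : ℝ) ^ 2) ^ s ≤ (Real.exp (4 / s) / 2) ^ s := by
          refine pow_le_pow_left₀ (by positivity) ?_ s
          have h := Real.add_one_le_exp (4 / (s : ℝ))
          refine le_trans ?_ (div_le_div_of_nonneg_right h zero_le_two)
          rw [div_le_iff₀ (by positivity)]
          have : (4 / (s : ℝ) + 1) / 2 * (s : ℝ) ^ 2 = (s : ℝ) ^ 2 / 2 + 2 * s := by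
            field_simp; ring
          linarith
      _ = Real.exp 4 / 2 ^ s := by
          rw [div_pow, ← Real.exp_nat_mul, mul_div_cancel₀ _ hs0.ne']
  have he : Real.exp 4 ≤ 81 := by
    calc Real.exp 4 = Real.exp 1 ^ 4 := by rw [← Real.exp_nat_mul]; norm_num
      _ ≤ 3 ^ 4 := pow_le_pow_left₀ (Real.exp_pos _).le Real.exp_one_lt_three.le 4
      _ = 81 := by norm_num
  have hsecond : Real.exp (-(2 * Real.exp 4)) ≤
      (1 - (((w : ℝ) + 1) / (s : ℝ) ^ 2) ^ s) ^ (2 ^ s - 1) := by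
    refine Real.exp_neg_le_one_sub_pow (by positivity) (hq.trans ?_) ?_
    · rw [div_le_iff₀ (by positivity)]; linarith
    · have hcast : ((2 ^ s - 1 : ℕ) : ℝ) ≤ 2 ^ s := by
        exact_mod_cast Nat.sub_le (2 ^ s) 1
      have := mul_le_mul hcast hq (by positivity) (by positivity)
      rw [mul_div_cancel₀ _ (by positivity)] at this
      linarith
  calc Real.exp (-4) * Real.exp (-(2 * Real.exp 4)) / 2 ^ s
      = Real.exp (-4) / 2 ^ s * Real.exp (-(2 * Real.exp 4)) := by ring
    _ ≤ _ := mul_le_mul hfirst hsecond (by positivity) (by positivity)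
end

section
/- There exist a real constant c > 0 and a natural s₀ such that for all naturals s ≥ s₀, setting n = s² and N = 2^s: among all triples (T, C, κ) with T : Fin N → (Fin s → Fin n), C : Fin N → Fin N → (Fin s → Fin n), and κ : Fin N → Fin N → Fin n, the fraction of triples for which the function f = f_{T,C,h} with h i j x = ¬ x (κ i j) satisfies 'for every monotone g : (Fin n → Bool) → Bool, the number of strings z with f z ≠ g z is at least c · 2^n' is at least c. (That is, a random no-instance is Ω(1)-far from monotone with probability Ω(1).) -/
open scoped Classical

open Finset in
theorem card_filter_apply_mem_of_ne_mem {ι α : Type*} [Fintype ι] [DecidableEq ι] [Fintype α]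
    (i : ι) (A B : Finset α) (p : (ι → α) → Prop) [DecidablePred p]
    (hp : ∀ t, p t ↔ t i ∈ A ∧ ∀ i', i' ≠ i → t i' ∈ B) :
    (univ.filter p).card = A.card * B.card ^ (Fintype.card ι - 1) := by
  have h : univ.filter p = Fintype.piFinset (Function.update (fun _ => B) i A) := by
    ext t
    simp only [mem_filter, mem_univ, true_and, Fintype.mem_piFinset, hp]
    constructor
    · rintro ⟨h1, h2⟩ i'
      by_cases h : i' = i
      · subst h; simpa using h1
      · simpa [Function.update_of_ne h] using h2 i' h
    · intro h
      refine ⟨by simpa using h i, fun i' hi' => ?_⟩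
      simpa [Function.update_of_ne hi'] using h i'
  have hcomp : (fun j => (Function.update (fun _ => B) i A j).card) =
      Function.update (fun _ => B.card) i A.card := by
    funext j
    by_cases h : j = i
    · subst h; simp
    · simp [Function.update_of_ne h]
  rw [h, Fintype.card_piFinset, hcomp, prod_update_of_mem (mem_univ i), prod_const,
    card_sdiff_of_subset (by simp)]
  simp

theorem exp_neg_two_mul_le_one_sub_pow {b M : ℝ} {m : ℕ} (hb : 0 ≤ b) (hM : 0 < M)
    (hbM : 2 * b ≤ M) (hm : (m : ℝ) ≤ M) :
    Real.exp (-(2 * b)) ≤ (1 - b / M) ^ m := by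
  have ht : b / M ≤ 1 / 2 := by rw [div_le_iff₀ hM]; linarith
  have ht0 : 0 ≤ b / M := by positivity
  have h1 : Real.exp (-(2 * (b / M))) ≤ 1 - b / M := by
    have h2 : 1 ≤ (1 - b / M) * (2 * (b / M) + 1) := by nlinarith
    have h3 : (1 - b / M) * (2 * (b / M) + 1) ≤ (1 - b / M) * Real.exp (2 * (b / M)) :=
      mul_le_mul_of_nonneg_left (Real.add_one_le_exp _) (by linarith)
    rw [Real.exp_neg, inv_le_iff_one_le_mul₀ (Real.exp_pos _)]
    exact h2.trans h3
  calc Real.exp (-(2 * b)) ≤ Real.exp (m * -(2 * (b / M))) := by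
        apply Real.exp_le_exp.2
        have : (m : ℝ) * (b / M) ≤ b := by
          calc (m : ℝ) * (b / M) ≤ M * (b / M) := mul_le_mul_of_nonneg_right hm ht0
            _ = b := by field_simp
        linarith
    _ = Real.exp (-(2 * (b / M))) ^ m := Real.exp_nat_mul _ _
    _ ≤ (1 - b / M) ^ m := pow_le_pow_left₀ (Real.exp_pos _).le h1 _

/-- `x` has weight within `s - 1` of the middle layer. -/
def IsCentral {n : ℕ} (s : ℕ) (x : Fin n → Bool) : Prop :=
  (n : ℝ) / 2 - s + 1 ≤ weight x ∧ (weight x : ℝ) ≤ (n : ℝ) / 2 + s - 1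

theorem flipCoord_flipCoord {n : ℕ} (x : Fin n → Bool) (k : Fin n) :
    flipCoord (flipCoord x k) k = x := by
  simp [flipCoord]

theorem flipCoord_not {n : ℕ} (x : Fin n → Bool) (k : Fin n) :
    flipCoord (fun l => !(x l)) k = fun l => !(flipCoord x k l) := by
  funext l
  by_cases h : l = k
  · subst h; simp [flipCoord]
  · simp [flipCoord, Function.update_of_ne h]

theorem weight_le_weight_flipCoord {n : ℕ} (x : Fin n → Bool) (k : Fin n) :
    weight x ≤ weight (flipCoord x k) + 1 := by
  refine (Finset.card_le_card ?_).trans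
    (Finset.card_insert_le k (Finset.univ.filter fun l => flipCoord x k l = true))
  intro l hl
  by_cases h : l = k
  · simp [h]
  · have hl' : x l = true := by simpa using hl
    exact Finset.mem_insert_of_mem
      (Finset.mem_filter.2 ⟨Finset.mem_univ l, by
        simpa [flipCoord, Function.update_of_ne h] using hl'⟩)

theorem weight_flipCoord_le_weight {n : ℕ} (x : Fin n → Bool) (k : Fin n) :
    weight (flipCoord x k) ≤ weight x + 1 := by
  simpa [flipCoord_flipCoord] using weight_le_weight_flipCoord (flipCoord x k) k

theorem weight_not {n : ℕ} (x : Fin n → Bool) :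
    (weight (fun l => !(x l)) : ℝ) = n - weight x := by
  have h := Finset.card_filter_add_card_filter_not (s := (Finset.univ : Finset (Fin n)))
    (fun k => x k = true)
  have h' : weight x + weight (fun l => !(x l)) = n := by
    simpa [weight] using h
  have h'' : (weight x : ℝ) + weight (fun l => !(x l)) = n := by exact_mod_cast h'
  linarith

theorem IsCentral.not {n s : ℕ} {x : Fin n → Bool} (hx : IsCentral s x) :
    IsCentral s (fun l => !(x l)) := by
  obtain ⟨h1, h2⟩ := hx
  constructor <;> rw [weight_not] <;> linarith

theorem falsifies_iff_satisfies_not {n s : ℕ} (x : Fin n → Bool) (t : Fin s → Fin n) :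
    Falsifies x t ↔ Satisfies (fun l => !(x l)) t := by
  simp [Falsifies, Satisfies]

/-- `i` is the only index whose term is satisfied by `x`, and likewise by `x` with coordinate `k`
flipped. -/
def IsolatedAcross {n s N : ℕ} (x : Fin n → Bool) (k : Fin n) (i : Fin N)
    (T : Fin N → Fin s → Fin n) : Prop :=
  (Satisfies x (T i) ∧ Satisfies (flipCoord x k) (T i)) ∧
    ∀ i', i' ≠ i → ¬ Satisfies x (T i') ∧ ¬ Satisfies (flipCoord x k) (T i')

theorem pow_le_card_satisfies_both {n s : ℕ} (x : Fin n → Bool) (k : Fin n) :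
    (weight x - 1) ^ s ≤ (Finset.univ.filter fun t : Fin s → Fin n =>
      Satisfies x t ∧ Satisfies (flipCoord x k) t).card := by
  calc (weight x - 1) ^ s
      ≤ (((Finset.univ.filter fun l => x l = true).erase k).card) ^ s :=
        Nat.pow_le_pow_left Finset.pred_card_le_card_erase _
    _ = (Fintype.piFinset fun _ : Fin s =>
          (Finset.univ.filter fun l => x l = true).erase k).card := by simp
    _ ≤ _ := by
        apply Finset.card_le_card
        intro t ht
        simp only [Fintype.mem_piFinset, Finset.mem_erase, Finset.mem_filter, Finset.mem_univ,
          true_and] at ht ⊢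
        refine ⟨fun m => (ht m).2, fun m => ?_⟩
        simpa [flipCoord, Function.update_of_ne (ht m).1] using (ht m).2

theorem card_le_card_satisfies_neither_add {n s : ℕ} (x : Fin n → Bool) (k : Fin n) :
    n ^ s ≤ (Finset.univ.filter fun t : Fin s → Fin n =>
      ¬ Satisfies x t ∧ ¬ Satisfies (flipCoord x k) t).card + (weight x + 1) ^ s := by
  have h := Finset.card_filter_add_card_filter_not (s := (Finset.univ : Finset (Fin s → Fin n)))
    (fun t => ¬ Satisfies x t ∧ ¬ Satisfies (flipCoord x k) t)
  have h' : (Finset.univ.filter fun t : Fin s → Fin n =>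
      ¬ (¬ Satisfies x t ∧ ¬ Satisfies (flipCoord x k) t)).card ≤ (weight x + 1) ^ s := by
    calc _ ≤ (Fintype.piFinset fun _ : Fin s =>
          insert k (Finset.univ.filter fun l => x l = true)).card := by
          apply Finset.card_le_card
          intro t ht
          simp only [Fintype.mem_piFinset, Finset.mem_insert, Finset.mem_filter, Finset.mem_univ,
            true_and, not_and_or, not_not] at ht ⊢
          intro m
          rcases ht with ht | ht
          · exact Or.inr (ht m)
          · by_cases hm : t m = k
            · exact Or.inl hm
            · refine Or.inr ?_
              simpa [flipCoord, Function.update_of_ne hm] using ht m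
      _ = (insert k (Finset.univ.filter fun l => x l = true)).card ^ s := by simp
      _ ≤ _ := Nat.pow_le_pow_left (Finset.card_insert_le _ _) _
  have hc : (Finset.univ : Finset (Fin s → Fin n)).card = n ^ s := by simp
  omega

theorem two_mul_exp_two_le_two_pow {s : ℕ} (hs : 5 ≤ s) : 2 * Real.exp 2 ≤ (2 : ℝ) ^ s := by
  have h : Real.exp 2 = Real.exp 1 * Real.exp 1 := by rw [← Real.exp_add]; norm_num
  have h1 := Real.exp_one_lt_d9
  have h0 := Real.exp_pos 1
  have h2 : (2 : ℝ) ^ 5 ≤ 2 ^ s := pow_le_pow_right₀ (by norm_num) hs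
  nlinarith

/-- A lower bound for `2 ^ s` times the probability that a given index is isolated. -/
noncomputable def isolationConst : ℝ := Real.exp (-4) * Real.exp (-(2 * Real.exp 2))

theorem isolationConst_pos : 0 < isolationConst := by
  unfold isolationConst; positivity

theorem le_card_isolatedAcross {s : ℕ} (hs : 5 ≤ s) {x : Fin (s ^ 2) → Bool} (hx : IsCentral s x)
    (k : Fin (s ^ 2)) (i : Fin (2 ^ s)) :
    isolationConst / 2 ^ s * (Fintype.card (Fin (2 ^ s) → Fin s → Fin (s ^ 2)) : ℝ) ≤
      (Finset.univ.filter fun T : Fin (2 ^ s) → Fin s → Fin (s ^ 2) =>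
        IsolatedAcross x k i T).card := by
  have hs0 : (5 : ℝ) ≤ s := by exact_mod_cast hs
  obtain ⟨hlo, hhi⟩ := hx
  push_cast at hlo hhi
  set P : ℝ := ((s : ℝ) ^ 2) ^ s with hP
  have hPpos : 0 < P := by positivity
  have hA : Real.exp (-4) / 2 ^ s * P ≤ ((Finset.univ.filter fun t : Fin s → Fin (s ^ 2) =>
      Satisfies x t ∧ Satisfies (flipCoord x k) t).card : ℝ) := by
    have h1 : Real.exp (-4) ≤ (1 - 2 / (s : ℝ)) ^ s := by
      have := exp_neg_two_mul_le_one_sub_pow (b := 2) (M := s) (m := s) (by norm_num)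
        (by linarith) (by linarith) le_rfl
      norm_num at this ⊢
      exact this
    have h2 : ((s : ℝ) ^ 2 / 2 - s) ^ s ≤ ((weight x - 1 : ℕ) : ℝ) ^ s := by
      apply pow_le_pow_left₀ (by nlinarith)
      have : (weight x : ℝ) ≤ ((weight x - 1 : ℕ) : ℝ) + 1 := by
        exact_mod_cast (by omega : weight x ≤ weight x - 1 + 1)
      linarith
    calc Real.exp (-4) / 2 ^ s * P ≤ (1 - 2 / (s : ℝ)) ^ s / 2 ^ s * P := by gcongr
      _ = ((s : ℝ) ^ 2 / 2 - s) ^ s := by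
        rw [hP, ← div_pow, ← mul_pow]
        congr 1
        field_simp
      _ ≤ _ := h2.trans (by exact_mod_cast pow_le_card_satisfies_both (s := s) x k)
  have hB : (1 - Real.exp 2 / 2 ^ s) * P ≤ ((Finset.univ.filter fun t : Fin s → Fin (s ^ 2) =>
      ¬ Satisfies x t ∧ ¬ Satisfies (flipCoord x k) t).card : ℝ) := by
    have h1 : (1 + 2 / (s : ℝ)) ^ s ≤ Real.exp 2 := by
      calc (1 + 2 / (s : ℝ)) ^ s ≤ Real.exp (2 / s) ^ s := by
            apply pow_le_pow_left₀ (by positivity)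
            linarith [Real.add_one_le_exp (2 / (s : ℝ))]
        _ = Real.exp 2 := by
            rw [← Real.exp_nat_mul]
            congr 1
            field_simp
    have h2 : ((weight x : ℝ) + 1) ^ s ≤ Real.exp 2 / 2 ^ s * P := by
      calc ((weight x : ℝ) + 1) ^ s ≤ ((s : ℝ) ^ 2 / 2 + s) ^ s :=
            pow_le_pow_left₀ (by positivity) (by linarith) _
        _ = (1 + 2 / (s : ℝ)) ^ s / 2 ^ s * P := by
            rw [hP, ← div_pow, ← mul_pow]
            congr 1
            field_simp
        _ ≤ _ := by gcongr
    have h3 : P ≤ ((Finset.univ.filter fun t : Fin s → Fin (s ^ 2) =>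
        ¬ Satisfies x t ∧ ¬ Satisfies (flipCoord x k) t).card : ℝ) + ((weight x : ℝ) + 1) ^ s := by
      rw [hP]
      exact_mod_cast card_le_card_satisfies_neither_add (s := s) x k
    linarith
  have hN := two_mul_exp_two_le_two_pow hs
  have hNpos : (0 : ℝ) < 2 ^ s := by positivity
  have hone : 0 ≤ 1 - Real.exp 2 / 2 ^ s := by
    rw [sub_nonneg, div_le_one hNpos]
    linarith [Real.exp_pos 2]
  have hE : Real.exp (-(2 * Real.exp 2)) ≤ (1 - Real.exp 2 / (2 : ℝ) ^ s) ^ (2 ^ s - 1) := by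
    apply exp_neg_two_mul_le_one_sub_pow (Real.exp_pos 2).le hNpos hN
    have : 2 ^ s - 1 ≤ 2 ^ s := Nat.sub_le _ _
    exact_mod_cast this
  rw [card_filter_apply_mem_of_ne_mem i
    (Finset.univ.filter fun t : Fin s → Fin (s ^ 2) =>
      Satisfies x t ∧ Satisfies (flipCoord x k) t)
    (Finset.univ.filter fun t : Fin s → Fin (s ^ 2) =>
      ¬ Satisfies x t ∧ ¬ Satisfies (flipCoord x k) t) _
    (by simp [IsolatedAcross]), Fintype.card_fin]
  have htot : (Fintype.card (Fin (2 ^ s) → Fin s → Fin (s ^ 2)) : ℝ) = P * P ^ (2 ^ s - 1) := by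
    have h2 : 2 ^ s - 1 + 1 = 2 ^ s := Nat.sub_add_cancel Nat.one_le_two_pow
    rw [← pow_succ', h2, hP]
    simp
  rw [htot]
  push_cast
  calc isolationConst / 2 ^ s * (P * P ^ (2 ^ s - 1))
      = (Real.exp (-4) / 2 ^ s * P) * (Real.exp (-(2 * Real.exp 2)) * P ^ (2 ^ s - 1)) := by
        unfold isolationConst; ring
    _ ≤ (Real.exp (-4) / 2 ^ s * P) * ((1 - Real.exp 2 / 2 ^ s) ^ (2 ^ s - 1) * P ^ (2 ^ s - 1)) := by
        gcongr
    _ = (Real.exp (-4) / 2 ^ s * P) * ((1 - Real.exp 2 / 2 ^ s) * P) ^ (2 ^ s - 1) := by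
        rw [mul_pow]
    _ ≤ _ := by
        apply mul_le_mul hA _ (by positivity) (by positivity)
        exact pow_le_pow_left₀ (by positivity) hB _

/-- `(i, j)` is the multiplexer value, witnessed by unique indices, both at `x` and at `x` with
coordinate `k` flipped. -/
def SelectedAcross {n s N : ℕ} (x : Fin n → Bool) (k : Fin n) (i j : Fin N)
    (T : Fin N → Fin s → Fin n) (C : Fin N → Fin N → Fin s → Fin n) : Prop :=
  IsolatedAcross x k i T ∧ IsolatedAcross (fun l => !(x l)) k j (C i)

theorem gamma_eq_inl {n s N : ℕ} {x : Fin n → Bool} {i j : Fin N}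
    {T : Fin N → Fin s → Fin n} {C : Fin N → Fin N → Fin s → Fin n}
    (hi : Satisfies x (T i)) (hi' : ∀ i', i' ≠ i → ¬ Satisfies x (T i'))
    (hj : Falsifies x (C i j)) (hj' : ∀ j', j' ≠ j → ¬ Falsifies x (C i j')) :
    Gamma T C x = Sum.inl (i, j) := by
  have h1 : ∃! i, Satisfies x (T i) :=
    ⟨i, hi, fun i' h => by_contra fun hne => hi' i' hne h⟩
  have e1 : Classical.choose h1 = i :=
    by_contra fun hne => hi' _ hne (Classical.choose_spec h1).1
  have h2 : ∃! j, Falsifies x (C (Classical.choose h1) j) := by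
    rw [e1]
    exact ⟨j, hj, fun j' h => by_contra fun hne => hj' j' hne h⟩
  have e2 : Classical.choose h2 = j := by
    by_contra hne
    have := (Classical.choose_spec h2).1
    exact hj' _ hne (by simpa only [e1] using this)
  unfold Gamma
  rw [dif_pos h1, dif_pos h2]
  exact congrArg Sum.inl (Prod.ext e1 e2)

theorem SelectedAcross.gamma_eq {n s N : ℕ} {x : Fin n → Bool} {k : Fin n} {i j : Fin N}
    {T : Fin N → Fin s → Fin n} {C : Fin N → Fin N → Fin s → Fin n}
    (h : SelectedAcross x k i j T C) :
    Gamma T C x = Sum.inl (i, j) ∧ Gamma T C (flipCoord x k) = Sum.inl (i, j) := by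
  obtain ⟨⟨⟨a, b⟩, c⟩, ⟨⟨d, e⟩, f⟩⟩ := h
  simp only [flipCoord_not, ← falsifies_iff_satisfies_not] at d e f
  exact ⟨gamma_eq_inl a (fun i' h => (c i' h).1) d (fun j' h => (f j' h).1),
    gamma_eq_inl b (fun i' h => (c i' h).2) e (fun j' h => (f j' h).2)⟩

/-- `x` is an endpoint of an edge, in the direction selected by the multiplexer, on which the
multiplexer is constant. -/
def IsEdgeEndpoint {n s N : ℕ} (T : Fin N → Fin s → Fin n)
    (C : Fin N → Fin N → Fin s → Fin n) (κ : Fin N → Fin N → Fin n) (x : Fin n → Bool) : Prop :=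
  IsCentral s x ∧ ∃ i j, SelectedAcross x (κ i j) i j T C

theorem fTCH_eq_of_gamma_eq {n s N : ℕ} {T : Fin N → Fin s → Fin n}
    {C : Fin N → Fin N → Fin s → Fin n} {h : Fin N → Fin N → (Fin n → Bool) → Bool}
    {x : Fin n → Bool} {i j : Fin N} (hlo : (n : ℝ) / 2 - s ≤ weight x)
    (hhi : (weight x : ℝ) ≤ (n : ℝ) / 2 + s) (hG : Gamma T C x = Sum.inl (i, j)) :
    fTCH T C h x = h i j x := by
  unfold fTCH
  rw [if_neg (not_lt.2 hhi), if_neg (not_lt.2 hlo), hG]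

/-- Flip the coordinate selected by the multiplexer. -/
noncomputable def partner {n s N : ℕ} (T : Fin N → Fin s → Fin n)
    (C : Fin N → Fin N → Fin s → Fin n) (κ : Fin N → Fin N → Fin n) (x : Fin n → Bool) :
    Fin n → Bool :=
  match Gamma T C x with
  | Sum.inl (i, j) => flipCoord x (κ i j)
  | Sum.inr _ => x

theorem partner_partner {n s N : ℕ} {T : Fin N → Fin s → Fin n}
    {C : Fin N → Fin N → Fin s → Fin n} {κ : Fin N → Fin N → Fin n} {x : Fin n → Bool}
    (hx : IsEdgeEndpoint T C κ x) : partner T C κ (partner T C κ x) = x := by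
  obtain ⟨-, i, j, h⟩ := hx
  obtain ⟨h1, h2⟩ := h.gamma_eq
  have e : partner T C κ x = flipCoord x (κ i j) := by simp [partner, h1]
  rw [e]
  simp [partner, h2, flipCoord_flipCoord]

theorem ne_or_ne_partner {n s N : ℕ} {T : Fin N → Fin s → Fin n}
    {C : Fin N → Fin N → Fin s → Fin n} {κ : Fin N → Fin N → Fin n} {x : Fin n → Bool}
    (hx : IsEdgeEndpoint T C κ x) {g : (Fin n → Bool) → Bool}
    (hg : ∀ x y : Fin n → Bool, (∀ k, x k = true → y k = true) → g x = true → g y = true) :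
    fTCH T C (fun i j z => !(z (κ i j))) x ≠ g x ∨
      fTCH T C (fun i j z => !(z (κ i j))) (partner T C κ x) ≠ g (partner T C κ x) := by
  obtain ⟨⟨hlo, hhi⟩, i, j, h⟩ := hx
  obtain ⟨h1, h2⟩ := h.gamma_eq
  have e : partner T C κ x = flipCoord x (κ i j) := by simp [partner, h1]
  have w1 : (weight x : ℝ) ≤ weight (flipCoord x (κ i j)) + 1 := by
    exact_mod_cast weight_le_weight_flipCoord x (κ i j)
  have w2 : (weight (flipCoord x (κ i j)) : ℝ) ≤ weight x + 1 := by
    exact_mod_cast weight_flipCoord_le_weight x (κ i j)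
  rw [e, fTCH_eq_of_gamma_eq (by linarith) (by linarith) h1,
    fTCH_eq_of_gamma_eq (by linarith) (by linarith) h2]
  have hk : flipCoord x (κ i j) (κ i j) = !(x (κ i j)) := by simp [flipCoord]
  rw [hk]
  by_contra! hcon
  obtain ⟨c1, c2⟩ := hcon
  cases hxk : x (κ i j) with
  | false =>
    rw [hxk] at c1 c2
    have := hg x (flipCoord x (κ i j)) (fun l hl => by
      have hne : l ≠ κ i j := by rintro rfl; simp [hxk] at hl
      simpa [flipCoord, Function.update_of_ne hne] using hl) (by simpa using c1.symm)
    simp [this] at c2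
  | true =>
    rw [hxk] at c1 c2
    have := hg (flipCoord x (κ i j)) x (fun l hl => by
      by_cases hne : l = κ i j
      · rw [hne, hxk]
      · simpa [flipCoord, Function.update_of_ne hne] using hl) (by simpa using c2.symm)
    simp [this] at c1

theorem card_isEdgeEndpoint_le {n s N : ℕ} (T : Fin N → Fin s → Fin n)
    (C : Fin N → Fin N → Fin s → Fin n) (κ : Fin N → Fin N → Fin n) {g : (Fin n → Bool) → Bool}
    (hg : ∀ x y : Fin n → Bool, (∀ k, x k = true → y k = true) → g x = true → g y = true) :
    (Finset.univ.filter fun x => IsEdgeEndpoint T C κ x).card ≤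
      2 * (Finset.univ.filter fun z => fTCH T C (fun i j z' => !(z' (κ i j))) z ≠ g z).card := by
  set M := Finset.univ.filter fun z => fTCH T C (fun i j z' => !(z' (κ i j))) z ≠ g z with hM
  have hsub : (Finset.univ.filter fun x => IsEdgeEndpoint T C κ x) ⊆
      M ∪ M.image (partner T C κ) := by
    intro x hx
    have hx' : IsEdgeEndpoint T C κ x := by simpa using hx
    rcases ne_or_ne_partner hx' hg with h | h
    · exact Finset.mem_union_left _ (by simpa [hM] using h)
    · refine Finset.mem_union_right _ (Finset.mem_image.2
        ⟨partner T C κ x, by simpa [hM] using h, partner_partner hx'⟩)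
  have h1 := Finset.card_le_card hsub
  have h2 := Finset.card_union_le M (M.image (partner T C κ))
  have h3 : (M.image (partner T C κ)).card ≤ M.card := Finset.card_image_le
  omega

theorem le_card_selectedAcross {s : ℕ} (hs : 5 ≤ s) {x : Fin (s ^ 2) → Bool} (hx : IsCentral s x)
    (k : Fin (s ^ 2)) (i j : Fin (2 ^ s)) :
    (isolationConst / 2 ^ s) ^ 2 *
        (Fintype.card ((Fin (2 ^ s) → Fin s → Fin (s ^ 2)) ×
          (Fin (2 ^ s) → Fin (2 ^ s) → Fin s → Fin (s ^ 2))) : ℝ) ≤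
      (Finset.univ.filter fun TC : (Fin (2 ^ s) → Fin s → Fin (s ^ 2)) ×
          (Fin (2 ^ s) → Fin (2 ^ s) → Fin s → Fin (s ^ 2)) =>
        SelectedAcross x k i j TC.1 TC.2).card := by
  have hprod : (Finset.univ.filter fun TC : (Fin (2 ^ s) → Fin s → Fin (s ^ 2)) ×
      (Fin (2 ^ s) → Fin (2 ^ s) → Fin s → Fin (s ^ 2)) => SelectedAcross x k i j TC.1 TC.2) =
      (Finset.univ.filter fun T => IsolatedAcross x k i T) ×ˢ
      (Finset.univ.filter fun C : Fin (2 ^ s) → Fin (2 ^ s) → Fin s → Fin (s ^ 2) =>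
        IsolatedAcross (fun l => !(x l)) k j (C i)) := by
    ext TC
    rw [Finset.mem_filter, Finset.mem_product, Finset.mem_filter, Finset.mem_filter]
    simp only [Finset.mem_univ, true_and, SelectedAcross]
  rw [hprod, Finset.card_product, card_filter_apply_mem_of_ne_mem i
    (Finset.univ.filter fun R => IsolatedAcross (fun l => !(x l)) k j R) Finset.univ
    (fun C : Fin (2 ^ s) → Fin (2 ^ s) → Fin s → Fin (s ^ 2) =>
      IsolatedAcross (fun l => !(x l)) k j (C i)) (by simp), Fintype.card_prod]
  have h1 := le_card_isolatedAcross hs hx k i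
  have h2 := le_card_isolatedAcross hs hx.not k j
  set α := Fin (2 ^ s) → Fin s → Fin (s ^ 2)
  have htot : (Fintype.card (Fin (2 ^ s) → α) : ℝ) =
      (Fintype.card α : ℝ) * (Fintype.card α : ℝ) ^ (2 ^ s - 1) := by
    have h2 : 2 ^ s - 1 + 1 = 2 ^ s := Nat.sub_add_cancel Nat.one_le_two_pow
    rw [← pow_succ', h2, Fintype.card_fun, Fintype.card_fin]
    push_cast
    rfl
  have hpos := isolationConst_pos
  push_cast
  rw [htot, Fintype.card_fin, Finset.card_univ]
  calc (isolationConst / 2 ^ s) ^ 2 * ((Fintype.card α : ℝ) *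
        ((Fintype.card α : ℝ) * (Fintype.card α : ℝ) ^ (2 ^ s - 1)))
      = (isolationConst / 2 ^ s * (Fintype.card α : ℝ)) *
        ((isolationConst / 2 ^ s * (Fintype.card α : ℝ)) *
          (Fintype.card α : ℝ) ^ (2 ^ s - 1)) := by ring
    _ ≤ _ := by gcongr

theorem le_card_isEdgeEndpoint {s : ℕ} (hs : 5 ≤ s) {x : Fin (s ^ 2) → Bool} (hx : IsCentral s x)
    (κ : Fin (2 ^ s) → Fin (2 ^ s) → Fin (s ^ 2)) :
    isolationConst ^ 2 *
        (Fintype.card ((Fin (2 ^ s) → Fin s → Fin (s ^ 2)) ×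
          (Fin (2 ^ s) → Fin (2 ^ s) → Fin s → Fin (s ^ 2))) : ℝ) ≤
      (Finset.univ.filter fun TC : (Fin (2 ^ s) → Fin s → Fin (s ^ 2)) ×
          (Fin (2 ^ s) → Fin (2 ^ s) → Fin s → Fin (s ^ 2)) =>
        IsEdgeEndpoint TC.1 TC.2 κ x).card := by
  set Ω := (Fin (2 ^ s) → Fin s → Fin (s ^ 2)) ×
    (Fin (2 ^ s) → Fin (2 ^ s) → Fin s → Fin (s ^ 2))
  let S : Fin (2 ^ s) × Fin (2 ^ s) → Finset Ω := fun p =>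
    Finset.univ.filter fun TC => SelectedAcross x (κ p.1 p.2) p.1 p.2 TC.1 TC.2
  have hunion : (Finset.univ.filter fun TC : Ω => IsEdgeEndpoint TC.1 TC.2 κ x) =
      Finset.univ.biUnion S := by
    ext TC
    simp [S, IsEdgeEndpoint, hx]
  rw [hunion, Finset.card_biUnion]
  · push_cast
    calc isolationConst ^ 2 * (Fintype.card Ω : ℝ)
        = ∑ _p : Fin (2 ^ s) × Fin (2 ^ s),
            (isolationConst / 2 ^ s) ^ 2 * (Fintype.card Ω : ℝ) := by
          have hc : Fintype.card (Fin (2 ^ s) × Fin (2 ^ s)) = 2 ^ s * 2 ^ s := by simp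
          rw [Finset.sum_const, Finset.card_univ, hc, nsmul_eq_mul]
          push_cast
          field_simp
      _ ≤ _ := Finset.sum_le_sum fun p _ => le_card_selectedAcross hs hx _ _ _
  · intro p _ q _ hpq
    refine Finset.disjoint_left.2 ?_
    intro TC hp hq
    have hp' : SelectedAcross x (κ p.1 p.2) p.1 p.2 TC.1 TC.2 := by simpa [S] using hp
    have hq' : SelectedAcross x (κ q.1 q.2) q.1 q.2 TC.1 TC.2 := by simpa [S] using hq
    exact hpq (Sum.inl_injective (hp'.gamma_eq.1.symm.trans hq'.gamma_eq.1))

theorem sum_sign_mul_sign {n : ℕ} (k l : Fin n) :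
    ∑ x : Fin n → Bool, (if x k then (1 : ℝ) else -1) * (if x l then 1 else -1) =
      if k = l then 2 ^ n else 0 := by
  split_ifs with h
  · subst h
    have : ∀ x : Fin n → Bool,
        (if x k then (1 : ℝ) else -1) * (if x k then 1 else -1) = 1 := by
      intro x; split_ifs <;> norm_num
    simp [this]
  · apply Finset.sum_involution (fun x _ => flipCoord x k)
    · intro x _
      have hk : flipCoord x k k = !(x k) := by simp [flipCoord]
      have hl : flipCoord x k l = x l := by simp [flipCoord, Function.update_of_ne (Ne.symm h)]
      rw [hk, hl]
      cases x k <;> cases x l <;> simp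
    · intro x _ _ he
      have hk : flipCoord x k k = !(x k) := by simp [flipCoord]
      rw [he] at hk
      simp at hk
    · simp
    · intro x _
      exact flipCoord_flipCoord x k

theorem sum_sign_eq {n : ℕ} (x : Fin n → Bool) :
    ∑ k, (if x k then (1 : ℝ) else -1) = 2 * weight x - n := by
  have : ∀ k, (if x k then (1 : ℝ) else -1) = 2 * (if x k = true then 1 else 0) - 1 := by
    intro k; split_ifs <;> norm_num
  simp_rw [this]
  rw [Finset.sum_sub_distrib, ← Finset.mul_sum, Finset.sum_boole]
  simp [weight]

theorem sum_sq_weight (n : ℕ) :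
    ∑ x : Fin n → Bool, (2 * (weight x : ℝ) - n) ^ 2 = (n : ℝ) * 2 ^ n := by
  simp_rw [← sum_sign_eq, sq, Finset.sum_mul_sum]
  rw [Finset.sum_comm]
  simp_rw [Finset.sum_comm (s := (Finset.univ : Finset (Fin n → Bool))), sum_sign_mul_sign]
  simp

theorem le_card_isCentral {s : ℕ} (hs : 5 ≤ s) :
    (2 : ℝ) ^ (s ^ 2) / 2 ≤
      (Finset.univ.filter fun x : Fin (s ^ 2) → Bool => IsCentral s x).card := by
  have hs0 : (5 : ℝ) ≤ s := by exact_mod_cast hs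
  have hsplit := Finset.card_filter_add_card_filter_not
    (s := (Finset.univ : Finset (Fin (s ^ 2) → Bool))) (fun x => IsCentral s x)
  have hc : (Finset.univ : Finset (Fin (s ^ 2) → Bool)).card = 2 ^ (s ^ 2) := by simp
  rw [hc] at hsplit
  have hsplit' : ((Finset.univ.filter fun x : Fin (s ^ 2) → Bool => IsCentral s x).card : ℝ) +
      (Finset.univ.filter fun x : Fin (s ^ 2) → Bool => ¬ IsCentral s x).card =
        2 ^ (s ^ 2) := by exact_mod_cast hsplit
  have hcheb : ((Finset.univ.filter fun x : Fin (s ^ 2) → Bool => ¬ IsCentral s x).card : ℝ) *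
      (4 * (s - 1) ^ 2) ≤ (s : ℝ) ^ 2 * 2 ^ (s ^ 2) := by
    calc _ = ∑ x ∈ Finset.univ.filter fun x : Fin (s ^ 2) → Bool => ¬ IsCentral s x,
          (4 * ((s : ℝ) - 1) ^ 2) := by simp
      _ ≤ ∑ x ∈ Finset.univ.filter fun x : Fin (s ^ 2) → Bool => ¬ IsCentral s x,
          (2 * (weight x : ℝ) - (s ^ 2 : ℕ)) ^ 2 := by
          apply Finset.sum_le_sum
          intro x hx
          have hx' : ¬ IsCentral s x := by simpa using hx
          unfold IsCentral at hx'
          rw [not_and_or, not_le, not_le] at hx'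
          rcases hx' with h | h <;> nlinarith
      _ ≤ ∑ x : Fin (s ^ 2) → Bool, (2 * (weight x : ℝ) - (s ^ 2 : ℕ)) ^ 2 :=
          Finset.sum_le_univ_sum_of_nonneg fun x => sq_nonneg _
      _ = _ := by rw [sum_sq_weight]; push_cast; ring
  have hR : (0 : ℝ) < 2 ^ (s ^ 2) := by positivity
  have h2 : 2 * (s : ℝ) ^ 2 ≤ 4 * ((s : ℝ) - 1) ^ 2 := by nlinarith
  set B := ((Finset.univ.filter fun x : Fin (s ^ 2) → Bool => ¬ IsCentral s x).card : ℝ)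
  have hB : 0 ≤ B := Nat.cast_nonneg _
  have h3 : B * (2 * (s : ℝ) ^ 2) ≤ (s : ℝ) ^ 2 * 2 ^ (s ^ 2) :=
    (mul_le_mul_of_nonneg_left h2 hB).trans hcheb
  have h4 : (2 * B) * (s : ℝ) ^ 2 ≤ 2 ^ (s ^ 2) * (s : ℝ) ^ 2 := by linarith
  have h5 := le_of_mul_le_mul_right h4 (by positivity)
  linarith

/-- A reverse Markov inequality for double counting. -/
theorem le_card_filter_of_le_sum {Ω X : Type*} [Fintype Ω] [Fintype X] (R : Ω → X → Prop) {a : ℝ}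
    (ha : 0 ≤ a)
    (h : 2 * a * (Fintype.card X * Fintype.card Ω) ≤
      ∑ ω : Ω, ((Finset.univ.filter fun x => R ω x).card : ℝ)) (hX : 0 < Fintype.card X) :
    a * Fintype.card Ω ≤ (Finset.univ.filter fun ω : Ω =>
      a * Fintype.card X ≤ ((Finset.univ.filter fun x => R ω x).card : ℝ)).card := by
  set G := Finset.univ.filter fun ω : Ω =>
      a * Fintype.card X ≤ ((Finset.univ.filter fun x => R ω x).card : ℝ) with hG
  have hX' : (0 : ℝ) < Fintype.card X := by exact_mod_cast hX
  have hsum : ∑ ω : Ω, ((Finset.univ.filter fun x => R ω x).card : ℝ) ≤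
      ∑ ω : Ω, (a * Fintype.card X + if ω ∈ G then (Fintype.card X : ℝ) else 0) := by
    apply Finset.sum_le_sum
    intro ω _
    split_ifs with hω
    · have : ((Finset.univ.filter fun x => R ω x).card : ℝ) ≤ Fintype.card X := by
        exact_mod_cast Finset.card_le_univ _
      nlinarith
    · have : ¬ a * Fintype.card X ≤ ((Finset.univ.filter fun x => R ω x).card : ℝ) := by
        simpa [hG] using hω
      linarith
  have heq : ∑ ω : Ω, (a * Fintype.card X + if ω ∈ G then (Fintype.card X : ℝ) else 0) =
      Fintype.card Ω * (a * Fintype.card X) + G.card * Fintype.card X := by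
    rw [Finset.sum_add_distrib, Finset.sum_ite_mem]
    simp
  rw [heq] at hsum
  have h1 : (a * Fintype.card Ω) * Fintype.card X ≤ G.card * (Fintype.card X : ℝ) := by
    linarith
  exact le_of_mul_le_mul_right h1 hX'

theorem le_sum_card_isEdgeEndpoint {s : ℕ} (hs : 5 ≤ s) :
    isolationConst ^ 2 / 2 * (Fintype.card (Fin (s ^ 2) → Bool) *
        Fintype.card ((Fin (2 ^ s) → Fin s → Fin (s ^ 2)) ×
          (Fin (2 ^ s) → Fin (2 ^ s) → Fin s → Fin (s ^ 2)) ×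
          (Fin (2 ^ s) → Fin (2 ^ s) → Fin (s ^ 2)))) ≤
      ∑ ω : (Fin (2 ^ s) → Fin s → Fin (s ^ 2)) ×
          (Fin (2 ^ s) → Fin (2 ^ s) → Fin s → Fin (s ^ 2)) ×
          (Fin (2 ^ s) → Fin (2 ^ s) → Fin (s ^ 2)),
        ((Finset.univ.filter fun x => IsEdgeEndpoint ω.1 ω.2.1 ω.2.2 x).card : ℝ) := by
  set α := Fin (2 ^ s) → Fin s → Fin (s ^ 2)
  set β := Fin (2 ^ s) → Fin (2 ^ s) → Fin s → Fin (s ^ 2)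
  set γ := Fin (2 ^ s) → Fin (2 ^ s) → Fin (s ^ 2)
  have hswap : ∑ ω : α × β × γ,
      ((Finset.univ.filter fun x => IsEdgeEndpoint ω.1 ω.2.1 ω.2.2 x).card : ℝ) =
      ∑ x : Fin (s ^ 2) → Bool, ∑ κ : γ,
        ((Finset.univ.filter fun TC : α × β => IsEdgeEndpoint TC.1 TC.2 κ x).card : ℝ) := by
    simp_rw [← Finset.sum_boole]
    rw [Finset.sum_comm]
    refine Finset.sum_congr rfl fun x _ => ?_
    rw [Finset.sum_comm, ← Equiv.sum_comp (Equiv.prodAssoc α β γ), Fintype.sum_prod_type]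
    rfl
  have hx : ∀ x ∈ Finset.univ.filter fun x : Fin (s ^ 2) → Bool => IsCentral s x,
      isolationConst ^ 2 * (Fintype.card (α × β) : ℝ) * Fintype.card γ ≤ ∑ κ : γ,
        ((Finset.univ.filter fun TC : α × β => IsEdgeEndpoint TC.1 TC.2 κ x).card : ℝ) := by
    intro x hx
    have hx' : IsCentral s x := by simpa using hx
    calc _ = ∑ _κ : γ, isolationConst ^ 2 * (Fintype.card (α × β) : ℝ) := by
          rw [Finset.sum_const, Finset.card_univ, nsmul_eq_mul]; ring
      _ ≤ _ := Finset.sum_le_sum fun κ _ => le_card_isEdgeEndpoint hs hx' κ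
  rw [hswap]
  have hcX : (Fintype.card (Fin (s ^ 2) → Bool) : ℝ) = 2 ^ (s ^ 2) := by simp
  have hcΩ : (Fintype.card (α × β × γ) : ℝ) = Fintype.card (α × β) * Fintype.card γ := by
    simp only [Fintype.card_prod]; push_cast; ring
  rw [hcX, hcΩ]
  have hpos := isolationConst_pos
  calc _ = (2 : ℝ) ^ (s ^ 2) / 2 *
        (isolationConst ^ 2 * (Fintype.card (α × β) : ℝ) * Fintype.card γ) := by ring
    _ ≤ (Finset.univ.filter fun x : Fin (s ^ 2) → Bool => IsCentral s x).card *
        (isolationConst ^ 2 * (Fintype.card (α × β) : ℝ) * Fintype.card γ) := by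
        gcongr
        exact le_card_isCentral hs
    _ = ∑ x ∈ Finset.univ.filter fun x : Fin (s ^ 2) → Bool => IsCentral s x,
        (isolationConst ^ 2 * (Fintype.card (α × β) : ℝ) * Fintype.card γ) := by
        rw [Finset.sum_const, nsmul_eq_mul]
    _ ≤ _ := Finset.sum_le_sum hx
    _ ≤ _ := Finset.sum_le_univ_sum_of_nonneg fun x =>
        Finset.sum_nonneg fun κ _ => Nat.cast_nonneg _

/-- a random no-instance is `Ω(1)`-far from monotone with
probability `Ω(1)`. -/
theorem statement11 : ∃ c : ℝ, 0 < c ∧ ∃ s₀ : ℕ, ∀ s : ℕ, s₀ ≤ s →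
    c ≤ (((Finset.univ.filter fun TCκ :
            (Fin (2 ^ s) → Fin s → Fin (s ^ 2)) ×
            (Fin (2 ^ s) → Fin (2 ^ s) → Fin s → Fin (s ^ 2)) ×
            (Fin (2 ^ s) → Fin (2 ^ s) → Fin (s ^ 2)) =>
          ∀ g : (Fin (s ^ 2) → Bool) → Bool,
            (∀ x y : Fin (s ^ 2) → Bool, (∀ k, x k = true → y k = true) →
              g x = true → g y = true) →
            c * 2 ^ (s ^ 2) ≤
              ((Finset.univ.filter fun z : Fin (s ^ 2) → Bool =>
                fTCH TCκ.1 TCκ.2.1 (fun i j z' => !(z' (TCκ.2.2 i j))) z ≠ g z).card : ℝ)).card : ℝ) /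
        (Fintype.card ((Fin (2 ^ s) → Fin s → Fin (s ^ 2)) ×
          (Fin (2 ^ s) → Fin (2 ^ s) → Fin s → Fin (s ^ 2)) ×
          (Fin (2 ^ s) → Fin (2 ^ s) → Fin (s ^ 2))))) := by
  have hpos := isolationConst_pos
  refine ⟨isolationConst ^ 2 / 8, by positivity, 5, fun s hs => ?_⟩
  have hcard : 0 < Fintype.card ((Fin (2 ^ s) → Fin s → Fin (s ^ 2)) ×
      (Fin (2 ^ s) → Fin (2 ^ s) → Fin s → Fin (s ^ 2)) ×
      (Fin (2 ^ s) → Fin (2 ^ s) → Fin (s ^ 2))) := by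
    have : Nonempty (Fin (s ^ 2)) := ⟨⟨0, by positivity⟩⟩
    exact Fintype.card_pos
  rw [le_div_iff₀ (by exact_mod_cast hcard)]
  have hsum := le_sum_card_isEdgeEndpoint hs
  have hmarkov := le_card_filter_of_le_sum (a := isolationConst ^ 2 / 4)
    (fun (ω : (Fin (2 ^ s) → Fin s → Fin (s ^ 2)) ×
        (Fin (2 ^ s) → Fin (2 ^ s) → Fin s → Fin (s ^ 2)) ×
        (Fin (2 ^ s) → Fin (2 ^ s) → Fin (s ^ 2))) x => IsEdgeEndpoint ω.1 ω.2.1 ω.2.2 x)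
    (by positivity) (by convert hsum using 2; ring) Fintype.card_pos
  refine le_trans ?_ (hmarkov.trans ?_)
  · gcongr
    norm_num
  · rw [Nat.cast_le]
    apply Finset.card_le_card
    intro ω hω
    simp only [Finset.mem_filter, Finset.mem_univ, true_and] at hω ⊢
    intro g hg
    have hle : ((Finset.univ.filter fun x => IsEdgeEndpoint ω.1 ω.2.1 ω.2.2 x).card : ℝ) ≤
        2 * ((Finset.univ.filter fun z : Fin (s ^ 2) → Bool =>
          fTCH ω.1 ω.2.1 (fun i j z' => !(z' (ω.2.2 i j))) z ≠ g z).card : ℝ) := by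
      exact_mod_cast card_isEdgeEndpoint_le ω.1 ω.2.1 ω.2.2 hg
    have hcX : (Fintype.card (Fin (s ^ 2) → Bool) : ℝ) = 2 ^ (s ^ 2) := by simp
    rw [hcX] at hω
    linarith
end

section
/- Let n, s be naturals and let P be a nonempty finite set of strings x : Fin n → Bool such that every x ∈ P satisfies (over ℝ) n/2 − s ≤ |x| ≤ n/2 + s. Let M ≥ 0 be a real number such that for all x, y ∈ P, the number of coordinates k with x k = false and y k = false is at least n/2 − M. Then the number of coordinates k with x k = true for every x ∈ P is at least n/2 − s − (|P| − 1)·(M + s). -/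
open scoped Classical

/-- Few coordinates are true in `x` and false in `y` if `y` is not too light and
`x`, `y` have many common zeros. -/
theorem card_true_false_le {n : ℕ} (x y : Fin n → Bool) (s M : ℝ)
    (hy : (n : ℝ) / 2 - s ≤ (weight y : ℝ))
    (hxy : (n : ℝ) / 2 - M ≤
      ((Finset.univ.filter fun k : Fin n => x k = false ∧ y k = false).card : ℝ)) :
    ((Finset.univ.filter fun k : Fin n => x k = true ∧ y k = false).card : ℝ) ≤ M + s := by
  have h : weight y + (Finset.univ.filter fun k : Fin n => x k = false ∧ y k = false).card +
      (Finset.univ.filter fun k : Fin n => x k = true ∧ y k = false).card = n := by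
    unfold weight
    simp only [Finset.card_filter]
    rw [← Finset.sum_add_distrib, ← Finset.sum_add_distrib]
    trans ∑ _k : Fin n, 1
    · refine Finset.sum_congr rfl fun k _ => ?_
      cases x k <;> cases y k <;> simp
    · simp
  have h' : (weight y : ℝ) +
      ((Finset.univ.filter fun k : Fin n => x k = false ∧ y k = false).card : ℝ) +
      ((Finset.univ.filter fun k : Fin n => x k = true ∧ y k = false).card : ℝ) = n := by
    exact_mod_cast h
  linarith

/-- A true coordinate of `x` is true in all of `P` or false in some other member of `P`. -/
theorem weight_le_card_add_sum {n : ℕ} (P : Finset (Fin n → Bool)) (x : Fin n → Bool) :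
    weight x ≤ (Finset.univ.filter fun k : Fin n => ∀ y ∈ P, y k = true).card +
      ∑ y ∈ P.erase x, (Finset.univ.filter fun k : Fin n => x k = true ∧ y k = false).card := by
  refine le_trans (Finset.card_le_card (t := (Finset.univ.filter fun k : Fin n =>
    ∀ y ∈ P, y k = true) ∪ (P.erase x).biUnion fun y =>
      Finset.univ.filter fun k : Fin n => x k = true ∧ y k = false) ?_)
    ((Finset.card_union_le _ _).trans (Nat.add_le_add_left Finset.card_biUnion_le _))
  intro k hk
  have hxk : x k = true := by simpa using hk
  by_cases h : ∀ y ∈ P, y k = true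
  · exact Finset.mem_union_left _ (by simpa using h)
  · push Not at h
    obtain ⟨y, hyP, hyk⟩ := h
    refine Finset.mem_union_right _ (Finset.mem_biUnion.2 ⟨y, ?_, ?_⟩)
    · exact Finset.mem_erase.2 ⟨fun e => hyk (e ▸ hxk), hyP⟩
    · simpa [hxk] using hyk

/-- lower bound on the number of coordinates that are `true` in
every string of a set `P` of middle-layer strings with large pairwise common
zero sets. -/
theorem statement13 (n s : ℕ) (P : Finset (Fin n → Bool)) (hne : P.Nonempty)
    (hmid : ∀ x ∈ P, (n : ℝ) / 2 - s ≤ (weight x : ℝ) ∧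
      (weight x : ℝ) ≤ (n : ℝ) / 2 + s)
    (M : ℝ) (hM : 0 ≤ M)
    (hcap : ∀ x ∈ P, ∀ y ∈ P, (n : ℝ) / 2 - M ≤
      ((Finset.univ.filter fun k : Fin n =>
        x k = false ∧ y k = false).card : ℝ)) :
    (n : ℝ) / 2 - s - ((P.card : ℝ) - 1) * (M + s) ≤
      ((Finset.univ.filter fun k : Fin n => ∀ x ∈ P, x k = true).card : ℝ) := by
  obtain ⟨x, hx⟩ := hne
  have hcount : (weight x : ℝ) ≤
      ((Finset.univ.filter fun k : Fin n => ∀ y ∈ P, y k = true).card : ℝ) +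
      ∑ y ∈ P.erase x,
        ((Finset.univ.filter fun k : Fin n => x k = true ∧ y k = false).card : ℝ) := by
    exact_mod_cast weight_le_card_add_sum P x
  have hsum : ∑ y ∈ P.erase x,
      ((Finset.univ.filter fun k : Fin n => x k = true ∧ y k = false).card : ℝ) ≤
      ((P.card : ℝ) - 1) * (M + s) := by
    have h := Finset.sum_le_card_nsmul (P.erase x) _ (M + s) fun y hy =>
      card_true_false_le x y s M (hmid y (Finset.mem_of_mem_erase hy)).1
        (hcap x hx y (Finset.mem_of_mem_erase hy))
    rwa [nsmul_eq_mul, Finset.cast_card_erase_of_mem hx] at h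
  linarith [(hmid x hx).1]
end

section
/- Let n, s, ℓ, q be naturals with ℓ + q ≤ s. Let A be a finite set of coordinates in Fin n, let Δ ⊆ A, and let R be a finite set of strings z : Fin n → Bool with |R| ≤ q. Define V as the set of maps T : Fin s → Fin n such that T m ∈ A \ Δ for every m and for every z ∈ R there exists m with z (T m) = false; define U as the set of maps T : Fin s → Fin n such that T m ∈ A for every m, the number of m with T m ∈ Δ is exactly ℓ, and for every z ∈ R there exists m with z (T m) = false. Then |V| · choose(s − q, ℓ) · |Δ|^ℓ ≤ |U| · |A \ Δ|^ℓ. -/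
open scoped Classical

theorem card_piFinset_ite_singleton {ι α : Type*} [Fintype ι] [DecidableEq ι]
    (L : Finset ι) (B : Finset α) (T : ι → α) :
    (Fintype.piFinset fun m => if m ∈ L then B else {T m}).card = B.card ^ L.card := by
  simp [Fintype.card_piFinset, apply_ite Finset.card, Finset.prod_ite_mem]

theorem filter_mem_eq_of_mem_piFinset_ite {ι α : Type*} [Fintype ι] [DecidableEq ι]
    [DecidableEq α] {L : Finset ι} {B : Finset α} {T T' : ι → α} (hT : ∀ m, T m ∉ B)
    (h : T' ∈ Fintype.piFinset fun m => if m ∈ L then B else {T m}) :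
    (Finset.univ.filter fun m => T' m ∈ B) = L := by
  ext m
  have hm := Fintype.mem_piFinset.1 h m
  by_cases hL : m ∈ L <;> simp_all

/-- Lower bound for the number of maps obtained from `T` by moving exactly `ℓ` values into `B`
while keeping the values on `Q`. -/
theorem card_choose_mul_pow_le_card_biUnion {s ℓ q : ℕ} {α : Type*} [DecidableEq α]
    (Q : Finset (Fin s)) (hQ : Q.card ≤ q) (B : Finset α) (T : Fin s → α)
    (hT : ∀ m, T m ∉ B) :
    Nat.choose (s - q) ℓ * B.card ^ ℓ ≤
      ((Finset.powersetCard ℓ Qᶜ).biUnion fun L =>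
        Fintype.piFinset fun m => if m ∈ L then B else {T m}).card := by
  rw [Finset.card_biUnion]
  · rw [Finset.sum_congr rfl fun L hL => by
      rw [card_piFinset_ite_singleton, (Finset.mem_powersetCard.1 hL).2]]
    rw [Finset.sum_const, Finset.card_powersetCard, Finset.card_compl, Fintype.card_fin,
      smul_eq_mul]
    gcongr
  · intro L _ L' _ hne
    refine Finset.disjoint_left.2 fun T' h h' => hne ?_
    rw [← filter_mem_eq_of_mem_piFinset_ite hT h, filter_mem_eq_of_mem_piFinset_ite hT h']

/-- bipartite double-counting inequality from the pruning
argument. -/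
theorem statement14 (n s ℓ q : ℕ) (hlq : ℓ + q ≤ s) (A Δ : Finset (Fin n))
    (hΔ : Δ ⊆ A) (R : Finset (Fin n → Bool)) (hR : R.card ≤ q) :
    (Finset.univ.filter fun T : Fin s → Fin n =>
        (∀ m, T m ∈ A \ Δ) ∧ ∀ z ∈ R, ∃ m, z (T m) = false).card *
      Nat.choose (s - q) ℓ * Δ.card ^ ℓ ≤
    (Finset.univ.filter fun T : Fin s → Fin n =>
        (∀ m, T m ∈ A) ∧
        (Finset.univ.filter fun m => T m ∈ Δ).card = ℓ ∧
        ∀ z ∈ R, ∃ m, z (T m) = false).card * (A \ Δ).card ^ ℓ := by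
  rw [mul_assoc]
  refine Finset.card_mul_le_card_mul (fun T T' => ∀ m, T' m ∉ Δ → T' m = T m) ?_ ?_
  · intro T hT
    obtain ⟨hTA, hTR⟩ := (Finset.mem_filter.1 hT).2
    have hT' : ∀ m, T m ∈ A ∧ T m ∉ Δ := fun m => Finset.mem_sdiff.1 (hTA m)
    choose w hw using hTR
    refine (card_choose_mul_pow_le_card_biUnion (R.attach.image fun z : {z // z ∈ R} => w z.1 z.2)
      (Finset.card_image_le.trans (R.card_attach.trans_le hR)) Δ T (fun m => (hT' m).2)).trans
      (Finset.card_le_card fun T' h => ?_)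
    obtain ⟨L, hL, hT'L⟩ := Finset.mem_biUnion.1 h
    obtain ⟨hLQ, hLc⟩ := Finset.mem_powersetCard.1 hL
    have hmem := filter_mem_eq_of_mem_piFinset_ite (fun m => (hT' m).2) hT'L
    have hin : ∀ m ∈ L, T' m ∈ Δ := fun m hm => by
      simpa [hm] using Fintype.mem_piFinset.1 hT'L m
    have hout : ∀ m ∉ L, T' m = T m := fun m hm => by
      simpa [hm] using Fintype.mem_piFinset.1 hT'L m
    refine Finset.mem_filter.2 ⟨Finset.mem_filter.2 ⟨Finset.mem_univ _, fun m => ?_,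
      hmem ▸ hLc, fun z hz => ⟨w z hz, ?_⟩⟩, fun m hm => hout m fun h => hm (hin m h)⟩
    · by_cases hm : m ∈ L
      · exact hΔ (hin m hm)
      · exact hout m hm ▸ (hT' m).1
    · rw [hout _ fun h => Finset.mem_compl.1 (hLQ h)
        (Finset.mem_image.2 ⟨⟨z, hz⟩, Finset.mem_attach _ _, rfl⟩)]
      exact hw z hz
  · intro T' hT'
    obtain ⟨-, hc, -⟩ := (Finset.mem_filter.1 hT').2
    rw [← hc, ← card_piFinset_ite_singleton _ _ T']
    refine Finset.card_le_card fun T hT => Fintype.mem_piFinset.2 fun m => ?_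
    obtain ⟨hT, hr⟩ := Finset.mem_filter.1 hT
    by_cases hm : T' m ∈ Δ
    · simpa [hm] using (Finset.mem_filter.1 hT).2.1 m
    · rw [if_neg (by simpa using hm), hr m hm]
      exact Finset.mem_singleton_self _
end

section
/- For every finite index set J, every family of nonnegative reals (p_j)_{j ∈ J}, and every real P ≥ 0, if the sum over j ∈ J of p_j is at most 2·P, then the sum over j ∈ J of min(p_j², P) is at most 2 · P^(3/2). -/
/-- The minimum of `x ^ 2` and `P` is at most their geometric mean. -/
theorem min_sq_le_sqrt_mul {x P : ℝ} (hx : 0 ≤ x) (hP : 0 ≤ P) :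
    min (x ^ 2) P ≤ √P * x := by
  rcases le_total x √P with h | h
  · calc min (x ^ 2) P ≤ x * x := (min_le_left _ _).trans_eq (sq x)
      _ ≤ √P * x := by gcongr
  · calc min (x ^ 2) P ≤ √P * √P := (min_le_right _ _).trans_eq (Real.mul_self_sqrt hP).symm
      _ ≤ √P * x := by gcongr

/-- if nonnegative reals sum to at most `2·P`, then the sum of
`min(p_j², P)` is at most `2·P^(3/2)`. -/
theorem statement15 {ι : Type*} (J : Finset ι) (p : ι → ℝ)
    (hp : ∀ j ∈ J, 0 ≤ p j) (P : ℝ) (hP : 0 ≤ P)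
    (hsum : ∑ j ∈ J, p j ≤ 2 * P) :
    ∑ j ∈ J, min ((p j) ^ 2) P ≤ 2 * P ^ ((3 : ℝ) / 2) := by
  have hpow : P ^ ((3 : ℝ) / 2) = P * √P := by
    rw [Real.sqrt_eq_rpow, show (3 : ℝ) / 2 = 1 + 1 / 2 by norm_num,
      Real.rpow_add_of_nonneg hP (by norm_num) (by norm_num), Real.rpow_one]
  calc ∑ j ∈ J, min ((p j) ^ 2) P ≤ ∑ j ∈ J, √P * p j :=
        Finset.sum_le_sum fun j hj => min_sq_le_sqrt_mul (hp j hj) hP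
    _ = √P * ∑ j ∈ J, p j := (Finset.mul_sum ..).symm
    _ ≤ √P * (2 * P) := by gcongr
    _ = 2 * P ^ ((3 : ℝ) / 2) := by rw [hpow]; ring
end

section
/- Let I be a finite index set, (P_i)_{i ∈ I} nonnegative reals, and q ≥ 0 a real with the sum over i ∈ I of P_i at most 2·q. For each i ∈ I let J_i be a finite index set and (p_{i,j})_{j ∈ J_i} nonnegative reals with the sum over j ∈ J_i of p_{i,j} at most 2·P_i. Then the double sum over i ∈ I and j ∈ J_i of min(p_{i,j}², P_i) is at most 2^(5/2) · q^(3/2). -/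
theorem min_sq_le_mul_sqrt {x a : ℝ} (hx : 0 ≤ x) (ha : 0 ≤ a) :
    min (x ^ 2) a ≤ x * √a := by
  rcases le_total x √a with h | h
  · exact (min_le_left _ _).trans (by nlinarith)
  · exact (min_le_right _ _).trans (by nlinarith [Real.mul_self_sqrt ha, Real.sqrt_nonneg a])

theorem sum_min_sq_le {κ : Type*} (J : Finset κ) (p : κ → ℝ) {a s : ℝ} (ha : 0 ≤ a)
    (hp : ∀ j ∈ J, 0 ≤ p j) (hs : ∑ j ∈ J, p j ≤ s) :
    ∑ j ∈ J, min ((p j) ^ 2) a ≤ s * √a :=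
  calc ∑ j ∈ J, min ((p j) ^ 2) a ≤ ∑ j ∈ J, p j * √a :=
        Finset.sum_le_sum fun j hj => min_sq_le_mul_sqrt (hp j hj) ha
    _ = (∑ j ∈ J, p j) * √a := (Finset.sum_mul ..).symm
    _ ≤ s * √a := by gcongr

/-- two-level version of the min-sum estimate. -/
theorem statement16 {ι κ : Type*} (I : Finset ι) (P : ι → ℝ)
    (hP : ∀ i ∈ I, 0 ≤ P i) (q : ℝ) (hq : 0 ≤ q)
    (hPsum : ∑ i ∈ I, P i ≤ 2 * q)
    (J : ι → Finset κ) (p : ι → κ → ℝ)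
    (hp : ∀ i ∈ I, ∀ j ∈ J i, 0 ≤ p i j)
    (hpsum : ∀ i ∈ I, ∑ j ∈ J i, p i j ≤ 2 * P i) :
    ∑ i ∈ I, ∑ j ∈ J i, min ((p i j) ^ 2) (P i) ≤
      2 ^ ((5 : ℝ) / 2) * q ^ ((3 : ℝ) / 2) := by
  have h2 : (2 : ℝ) ^ ((5 : ℝ) / 2) = 4 * √2 := by
    rw [show (5 : ℝ) / 2 = 2 + 1 / 2 by norm_num, Real.rpow_add two_pos, Real.sqrt_eq_rpow]
    norm_num
  have hq' : q ^ ((3 : ℝ) / 2) = q * √q := by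
    rw [show (3 : ℝ) / 2 = 1 + 1 / 2 by norm_num,
      Real.rpow_add_of_nonneg hq zero_le_one (by norm_num), Real.rpow_one, Real.sqrt_eq_rpow]
  calc ∑ i ∈ I, ∑ j ∈ J i, min ((p i j) ^ 2) (P i)
      ≤ ∑ i ∈ I, 2 * P i * √(2 * q) := by
        refine Finset.sum_le_sum fun i hi => ?_
        have hPi := hP i hi
        have hle : P i ≤ 2 * q := (Finset.single_le_sum hP hi).trans hPsum
        refine (sum_min_sq_le (J i) (p i) hPi (hp i hi) (hpsum i hi)).trans ?_
        gcongr
    _ = 2 * (∑ i ∈ I, P i) * √(2 * q) := by rw [← Finset.sum_mul, ← Finset.mul_sum]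
    _ ≤ 2 * (2 * q) * √(2 * q) := by gcongr
    _ = 2 ^ ((5 : ℝ) / 2) * q ^ ((3 : ℝ) / 2) := by
        rw [h2, hq', Real.sqrt_mul zero_le_two]
        ring
end
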